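/- The kernel of φ equals the subgroup of G generated by the three elements x₀ = b·a, x₁ = a·b, and x₂ = b⁻¹·a·b². -/

import Mathlib

/-- The generator `a` of the free group on two generators. -/
def fa : FreeGroup (Fin 2) := FreeGroup.of 0
/-- The generator `b` of the free group on two generators. -/
def fb : FreeGroup (Fin 2) := FreeGroup.of 1

/-- The two relators `(b·a²)·(a³·b²)⁻¹` and `(b²·a)·(a²·b³)⁻¹`. -/
def csRels : Set (FreeGroup (Fin 2)) :=
  {(fb * fa ^ 2) * (fa ^ 3 * fb ^ 2)⁻¹, (fb ^ 2 * fa) * (fa ^ 2 * fb ^ 3)⁻¹}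

/-- The group `G = ⟨a, b ∣ b·a² = a³·b², b²·a = a²·b³⟩`. -/
abbrev G : Type := PresentedGroup csRels

/-- The image of `a` in `G`. -/
def ga : G := PresentedGroup.of 0
/-- The image of `b` in `G`. -/
def gb : G := PresentedGroup.of 1

theorem rel_one : gb * ga ^ 2 = ga ^ 3 * gb ^ 2 := by
  have h : (PresentedGroup.mk csRels) ((fb * fa ^ 2) * (fa ^ 3 * fb ^ 2)⁻¹) = 1 :=
    PresentedGroup.one_of_mem (by simp [csRels])
  rw [map_mul, map_inv, mul_inv_eq_one] at h
  simp only [map_mul, map_pow] at h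
  exact h

theorem rel_two : gb ^ 2 * ga = ga ^ 2 * gb ^ 3 := by
  have h : (PresentedGroup.mk csRels) ((fb ^ 2 * fa) * (fa ^ 2 * fb ^ 3)⁻¹) = 1 :=
    PresentedGroup.one_of_mem (by simp [csRels])
  rw [map_mul, map_inv, mul_inv_eq_one] at h
  simp only [map_mul, map_pow] at h
  exact h

/-- The subgroup generated by the three elements. -/
def xH : Subgroup G := Subgroup.closure {gb * ga, ga * gb, gb⁻¹ * ga * gb ^ 2}

theorem x0_mem : gb * ga ∈ xH := Subgroup.subset_closure (by simp)
theorem x1_mem : ga * gb ∈ xH := Subgroup.subset_closure (by simp)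
theorem x2_mem : gb⁻¹ * ga * gb ^ 2 ∈ xH := Subgroup.subset_closure (by simp)

theorem conj_b (h : G) (hh : h ∈ xH) : gb * h * gb⁻¹ ∈ xH := by
  have : xH ≤ xH.comap (MulAut.conj gb).toMonoidHom := by
    refine (Subgroup.closure_le _).2 ?_
    rintro x (rfl | rfl | rfl)
    · change gb * (gb * ga) * gb⁻¹ ∈ xH
      have e : gb * (gb * ga) * gb⁻¹ = (ga * gb) * (gb⁻¹ * ga * gb ^ 2) := by
        rw [← mul_assoc, ← pow_two, rel_two]; simp [pow_succ, mul_assoc]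
      rw [e]; exact mul_mem x1_mem x2_mem
    · change gb * (ga * gb) * gb⁻¹ ∈ xH
      convert x0_mem using 1; group
    · change gb * (gb⁻¹ * ga * gb ^ 2) * gb⁻¹ ∈ xH
      convert x1_mem using 1; group
  exact this hh

theorem conj_b_inv (h : G) (hh : h ∈ xH) : gb⁻¹ * h * gb ∈ xH := by
  have : xH ≤ xH.comap (MulAut.conj gb⁻¹).toMonoidHom := by
    refine (Subgroup.closure_le _).2 ?_
    rintro x (rfl | rfl | rfl)
    · change gb⁻¹ * (gb * ga) * gb⁻¹⁻¹ ∈ xH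
      convert x1_mem using 1; group
    · change gb⁻¹ * (ga * gb) * gb⁻¹⁻¹ ∈ xH
      convert x2_mem using 1; simp [pow_succ, mul_assoc]
    · change gb⁻¹ * (gb⁻¹ * ga * gb ^ 2) * gb⁻¹⁻¹ ∈ xH
      have e : gb⁻¹ * (gb⁻¹ * ga * gb ^ 2) * gb⁻¹⁻¹ =
          (gb⁻¹ * ga * gb ^ 2)⁻¹ * (ga * gb)⁻¹ * ((gb * ga) * (ga * gb)) := by
        have e2 : (gb * ga) * (ga * gb) = (gb * ga ^ 2) * gb := by simp [pow_succ, mul_assoc]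
        rw [e2, rel_one]; simp [pow_succ, mul_assoc]
      rw [e]
      exact mul_mem (mul_mem (inv_mem x2_mem) (inv_mem x1_mem)) (mul_mem x0_mem x1_mem)
  simpa using this hh

theorem xH_normal : xH.Normal := by
  rw [← Subgroup.normalizer_eq_top_iff, eq_top_iff, ← PresentedGroup.closure_range_of,
    Subgroup.closure_le]
  have hb : gb ∈ Subgroup.normalizer (xH : Set G) := by
    rw [Subgroup.mem_normalizer_iff]
    refine fun h => ⟨conj_b h, fun hh => ?_⟩
    have := conj_b_inv _ hh
    convert this using 1; group
  have ha : ga ∈ Subgroup.normalizer (xH : Set G) := by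
    have : ga = gb⁻¹ * (gb * ga) := by group
    rw [this]
    exact mul_mem (inv_mem hb) (Subgroup.le_normalizer x0_mem)
  rintro _ ⟨i, rfl⟩
  fin_cases i
  · exact ha
  · exact hb

/-- For the (unique) homomorphism `φ : G → ℤ` with `φ(a) = −1` and `φ(b) = 1`, the kernel
of `φ` equals the subgroup generated by `x₀ = b·a`, `x₁ = a·b` and `x₂ = b⁻¹·a·b²`. -/
theorem ker_eq_closure_of_x
    (φ : G →* Multiplicative ℤ)
    (ha : φ ga = Multiplicative.ofAdd (-1))
    (hb : φ gb = Multiplicative.ofAdd 1) :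
    φ.ker = Subgroup.closure {gb * ga, ga * gb, gb⁻¹ * ga * gb ^ 2} := by
  change φ.ker = xH
  have := xH_normal
  apply le_antisymm
  · have key : QuotientGroup.mk' xH =
        (zpowersHom (G ⧸ xH) (QuotientGroup.mk' xH gb)).comp φ := by
      refine PresentedGroup.ext fun i => ?_
      fin_cases i
      · change QuotientGroup.mk' xH ga = zpowersHom (G ⧸ xH) (QuotientGroup.mk' xH gb) (φ ga)
        rw [ha, zpowersHom_apply, toAdd_ofAdd, zpow_neg_one, eq_inv_iff_mul_eq_one, ← map_mul]
        exact (QuotientGroup.eq_one_iff _).2 x1_mem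
      · change QuotientGroup.mk' xH gb = zpowersHom (G ⧸ xH) (QuotientGroup.mk' xH gb) (φ gb)
        rw [hb, zpowersHom_apply, toAdd_ofAdd, zpow_one]
    intro g hg
    have h1 := DFunLike.congr_fun key g
    rw [MonoidHom.comp_apply, MonoidHom.mem_ker.1 hg, map_one] at h1
    exact (QuotientGroup.eq_one_iff _).1 h1
  · refine (Subgroup.closure_le _).2 ?_
    rintro x (rfl | rfl | rfl) <;>
      simp only [SetLike.mem_coe, MonoidHom.mem_ker, map_mul, map_pow, map_inv, ha, hb] <;> rfl
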